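/- arXiv:2107.08332 — 5 statements merged into one kernel-verified Lean document; each statement's English description precedes it below -/
import Mathlib

section
/- Let Σ be a topological space and let A be a closed subalgebra of the Banach algebra C_b(Σ, ℂ) of bounded continuous complex-valued functions on Σ (with the supremum norm) that contains the constant functions and separates the points of Σ. Let f₁,…,f_m ∈ A, and let B = A[f̄₁,…,f̄_m] be the smallest closed subalgebra of C_b(Σ, ℂ) containing A and the complex conjugates f̄₁,…,f̄_m. If φ₁ and φ₂ are characters of B (nonzero continuous multiplicative ℂ-linear functionals) whose restrictions to A coincide, then φ₁ = φ₂. -/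
open BoundedContinuousFunction WeakDual

/-- A character of a closed subalgebra of a commutative C⋆-algebra respects every adjoint that
happens to lie in the subalgebra. -/
theorem WeakDual.CharacterSpace.map_star_of_mem {E : Type*} [CommCStarAlgebra E]
    {B : Subalgebra ℂ E} (hB : IsClosed (B : Set E)) (φ : characterSpace ℂ B) {x : E}
    (hx : x ∈ B) (hx' : star x ∈ B) : φ ⟨star x, hx'⟩ = star (φ ⟨x, hx⟩) := by
  have hle : (StarAlgebra.elemental ℂ x).toSubalgebra ≤ B := by
    refine Subalgebra.topologicalClosure_minimal
      (s := (StarAlgebra.adjoin ℂ {x}).toSubalgebra) ?_ hB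
    rw [StarAlgebra.adjoin_toSubalgebra]
    refine Algebra.adjoin_le (Set.union_subset ?_ ?_)
    · simpa using hx
    · simpa [Set.star_singleton] using hx'
  let ψ : StarAlgebra.elemental ℂ x →ₐ[ℂ] ℂ :=
    (CharacterSpace.toAlgHom φ).comp (Subalgebra.inclusion hle)
  exact map_star ψ ⟨x, StarAlgebra.elemental.self_mem ℂ x⟩

/-- Two characters of the closed subalgebra generated by `s` agree if they agree on `s`. -/
theorem WeakDual.CharacterSpace.ext_of_eq_topologicalClosure_adjoin {E : Type*} [NormedRing E]
    [NormedAlgebra ℂ E] {B : Subalgebra ℂ E} {s : Set E}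
    (hB : B = (Algebra.adjoin ℂ s).topologicalClosure) (φ₁ φ₂ : characterSpace ℂ B)
    (h : ∀ b : B, (b : E) ∈ s → φ₁ b = φ₂ b) : φ₁ = φ₂ := by
  have hBclosed : IsClosed (B : Set E) := hB ▸ Subalgebra.isClosed_topologicalClosure _
  let K : Subalgebra ℂ B :=
    AlgHom.equalizer (CharacterSpace.toAlgHom φ₁) (CharacterSpace.toAlgHom φ₂)
  have hK : IsClosed (K : Set B) :=
    isClosed_eq (map_continuous φ₁) (map_continuous φ₂)
  have hs : s ⊆ B := fun x hx => by
    rw [hB]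
    exact Subalgebra.le_topologicalClosure _ (Algebra.subset_adjoin hx)
  have hle : B ≤ K.map B.val := by
    conv_lhs => rw [hB]
    refine Subalgebra.topologicalClosure_minimal (Algebra.adjoin_le fun x hx => ?_) ?_
    · exact ⟨⟨x, hs hx⟩, h ⟨x, hs hx⟩ hx, rfl⟩
    · exact hBclosed.isClosedEmbedding_subtypeVal.isClosedMap _ hK
  ext b
  obtain ⟨c, hc, hcb⟩ := hle b.2
  obtain rfl : c = b := Subtype.ext hcb
  exact hc

/-- Injectivity of restriction of characters from `B = A[f̄₁,…,f̄ₘ]` to `A`. -/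
theorem restriction_of_characters_injective
    {S : Type*} [TopologicalSpace S] (A : Subalgebra ℂ (S →ᵇ ℂ))
    (hAclosed : IsClosed (A : Set (S →ᵇ ℂ)))
    (hAsep : ∀ x y : S, x ≠ y → ∃ f ∈ A, f x ≠ f y)
    (m : ℕ) (f : Fin m → (S →ᵇ ℂ)) (hf : ∀ j, f j ∈ A)
    (B : Subalgebra ℂ (S →ᵇ ℂ))
    (hB : B = (Algebra.adjoin ℂ ((A : Set (S →ᵇ ℂ)) ∪ Set.range fun j => star (f j))).topologicalClosure)
    (φ₁ φ₂ : characterSpace ℂ B)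
    (h : ∀ (b : B), (b : S →ᵇ ℂ) ∈ A → φ₁ b = φ₂ b) :
    φ₁ = φ₂ := by
  have hBclosed : IsClosed (B : Set (S →ᵇ ℂ)) := hB ▸ Subalgebra.isClosed_topologicalClosure _
  refine CharacterSpace.ext_of_eq_topologicalClosure_adjoin hB φ₁ φ₂ ?_
  rintro ⟨b, hb⟩ (hbA | ⟨j, rfl⟩)
  · exact h _ hbA
  · have hfB : f j ∈ B := by
      rw [hB]
      exact Subalgebra.le_topologicalClosure _ (Algebra.subset_adjoin (Or.inl (hf j)))
    rw [CharacterSpace.map_star_of_mem hBclosed φ₁ hfB hb,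
      CharacterSpace.map_star_of_mem hBclosed φ₂ hfB hb, h ⟨f j, hfB⟩ (hf j)]
end

section
/- Let X be a compact Hausdorff topological space, let A be a closed subalgebra of C(X, ℂ) (with the supremum norm) containing the constant functions, and let φ be a character of A. Then there exists a regular Borel probability measure μ on X such that φ(f) = ∫_X f dμ for every f ∈ A (a representing measure for φ). -/
open WeakDual MeasureTheory

section UnitalContraction

open CompactlySupported

variable {X : Type*} [TopologicalSpace X] [CompactSpace X]

/-- The inclusion of the real-valued continuous functions into the complex-valued ones. -/
noncomputable def complexifyCLM (X : Type*) [TopologicalSpace X] [CompactSpace X] :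
    C(X, ℝ) →L[ℝ] C(X, ℂ) :=
  Complex.ofRealCLM.compLeftContinuous ℝ X

@[simp]
lemma complexifyCLM_apply (f : C(X, ℝ)) (x : X) : complexifyCLM X f x = (f x : ℂ) := rfl

lemma norm_complexifyCLM_le (f : C(X, ℝ)) : ‖complexifyCLM X f‖ ≤ ‖f‖ :=
  (ContinuousMap.norm_le _ (norm_nonneg f)).2 fun x => by
    simpa using f.norm_coe_le_norm x

/-- A contractive unital functional on `C(X, ℂ)` is real on real-valued functions. -/
lemma im_apply_complexifyCLM_eq_zero {g : StrongDual ℂ C(X, ℂ)} (hg : ‖g‖ ≤ 1) (hg1 : g 1 = 1)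
    (f : C(X, ℝ)) : (g (complexifyCLM X f)).im = 0 := by
  by_contra hb
  set b := (g (complexifyCLM X f)).im with hbdef
  have key (t : ℝ) : (b + t) ^ 2 ≤ ‖f‖ ^ 2 + t ^ 2 := by
    have hnorm : ‖complexifyCLM X f + (t * Complex.I : ℂ) • (1 : C(X, ℂ))‖
        ≤ √(‖f‖ ^ 2 + t ^ 2) := by
      refine (ContinuousMap.norm_le _ (Real.sqrt_nonneg _)).2 fun x => ?_
      have hx : f x ^ 2 ≤ ‖f‖ ^ 2 := by
        simpa using pow_le_pow_left₀ (norm_nonneg _) (f.norm_coe_le_norm x) 2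
      simp only [ContinuousMap.add_apply, complexifyCLM_apply, ContinuousMap.smul_apply,
        ContinuousMap.one_apply, smul_eq_mul, mul_one, Complex.norm_add_mul_I]
      gcongr
    have him := (Complex.abs_im_le_norm _).trans
      ((g.le_of_opNorm_le hg _).trans ((one_mul _).le.trans hnorm))
    rw [map_add, map_smul, hg1] at him
    have him' : |b + t| ≤ √(‖f‖ ^ 2 + t ^ 2) := by simpa [hbdef] using him
    rw [← sq_abs]
    exact (Real.le_sqrt (abs_nonneg _) (by positivity)).1 him'
  have h := key ((‖f‖ ^ 2 + 1) / (2 * b))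
  have h2 : 2 * b * ((‖f‖ ^ 2 + 1) / (2 * b)) = ‖f‖ ^ 2 + 1 := by field_simp
  nlinarith [sq_nonneg b]

/-- A contractive unital functional on `C(X, ℂ)` is positive. -/
lemma re_apply_complexifyCLM_nonneg {g : StrongDual ℂ C(X, ℂ)} (hg : ‖g‖ ≤ 1) (hg1 : g 1 = 1)
    {f : C(X, ℝ)} (hf : 0 ≤ f) : 0 ≤ (g (complexifyCLM X f)).re := by
  have hnorm : ‖(‖f‖ : ℂ) • (1 : C(X, ℂ)) - complexifyCLM X f‖ ≤ ‖f‖ := by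
    refine (ContinuousMap.norm_le _ (norm_nonneg f)).2 fun x => ?_
    have h0 : 0 ≤ f x := hf x
    have h1 : f x ≤ ‖f‖ := f.apply_le_norm x
    simp only [ContinuousMap.sub_apply, complexifyCLM_apply, ContinuousMap.smul_apply,
      ContinuousMap.one_apply, smul_eq_mul, mul_one]
    rw [← Complex.ofReal_sub, Complex.norm_real, Real.norm_eq_abs, abs_le]
    constructor <;> linarith
  have hre := (Complex.re_le_norm _).trans
    ((g.le_of_opNorm_le hg _).trans ((one_mul _).le.trans hnorm))
  rw [map_sub, map_smul, hg1] at hre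
  simp only [smul_eq_mul, mul_one, Complex.sub_re, Complex.ofReal_re] at hre
  linarith

/-- The positive functional on `C_c(X, ℝ)` induced by a contractive unital functional on
`C(X, ℂ)`. -/
noncomputable def rePositiveLinearMap {g : StrongDual ℂ C(X, ℂ)} (hg : ‖g‖ ≤ 1)
    (hg1 : g 1 = 1) : C_c(X, ℝ) →ₚ[ℝ] ℝ :=
  PositiveLinearMap.mk₀
    { toFun f := (g (complexifyCLM X (f : C(X, ℝ)))).re
      map_add' f f' := by
        rw [← Complex.add_re, ← map_add, ← map_add]; rfl
      map_smul' c f := by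
        have : complexifyCLM X ((c • f : C_c(X, ℝ)) : C(X, ℝ))
            = (c : ℂ) • complexifyCLM X (f : C(X, ℝ)) := by
          ext x; simp
        rw [this, map_smul]; simp }
    fun _ hf => re_apply_complexifyCLM_nonneg hg hg1 hf

/-- Contractive unital functionals on `C(X, ℂ)` are given by regular probability measures. -/
theorem exists_regular_isProbabilityMeasure_integral_eq [T2Space X] [MeasurableSpace X]
    [BorelSpace X] {g : StrongDual ℂ C(X, ℂ)} (hg : ‖g‖ ≤ 1) (hg1 : g 1 = 1) :
    ∃ μ : Measure X, μ.Regular ∧ IsProbabilityMeasure μ ∧ ∀ f : C(X, ℂ), g f = ∫ x, f x ∂μ := by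
  set μ := RealRMK.rieszMeasure (rePositiveLinearMap hg hg1)
  have hreal (f : C(X, ℝ)) : g (complexifyCLM X f) = ((∫ x, f x ∂μ : ℝ) : ℂ) := by
    have h : ∫ x, f x ∂μ = (g (complexifyCLM X f)).re :=
      RealRMK.integral_rieszMeasure (rePositiveLinearMap hg hg1)
        (CompactlySupportedContinuousMap.continuousMapEquiv f)
    rw [h]
    exact Complex.ext rfl (im_apply_complexifyCLM_eq_zero hg hg1 f)
  refine ⟨μ, inferInstance, ⟨?_⟩, fun f => ?_⟩
  · have h1 : complexifyCLM X 1 = 1 := by ext x; simp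
    have h := hreal 1
    rw [h1, hg1] at h
    have h' : μ.real Set.univ = 1 := by simpa using (Complex.ofReal_injective h).symm
    simpa [Measure.real, ENNReal.toReal_eq_one_iff] using h'
  · let u : C(X, ℝ) := ⟨fun x => (f x).re, by fun_prop⟩
    let v : C(X, ℝ) := ⟨fun x => (f x).im, by fun_prop⟩
    have hf : f = complexifyCLM X u + Complex.I • complexifyCLM X v := by
      ext x
      simp [u, v, mul_comm Complex.I, Complex.re_add_im]
    have hint : Integrable (fun x => f x) μ :=
      f.continuous.integrable_of_hasCompactSupport (HasCompactSupport.of_compactSpace f)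
    have hsum := integral_re_add_im hint
    rw [← hsum]
    conv_lhs => rw [hf, map_add, map_smul, hreal, hreal]
    simp [u, v, mul_comm]

end UnitalContraction

/-- Existence of representing measures for characters of a closed
subalgebra of `C(X, ℂ)`. -/
theorem exists_representing_measure
    {X : Type*} [TopologicalSpace X] [CompactSpace X] [T2Space X]
    [MeasurableSpace X] [BorelSpace X]
    (A : Subalgebra ℂ C(X, ℂ)) (hAclosed : IsClosed (A : Set C(X, ℂ)))
    (φ : characterSpace ℂ A) :
    ∃ μ : Measure X, μ.Regular ∧ IsProbabilityMeasure μ ∧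
      ∀ f : A, φ f = ∫ x, (f : C(X, ℂ)) x ∂μ := by
  have : CompleteSpace A := hAclosed.completeSpace_coe
  have h1 : ‖(1 : A)‖ ≤ 1 :=
    (ContinuousMap.norm_le (1 : C(X, ℂ)) zero_le_one).2 fun x => by simp
  obtain ⟨g, hgφ, hgn⟩ := exists_extension_norm_eq (Subalgebra.toSubmodule A)
    (toStrongDual (φ : WeakDual ℂ A))
  have hg : ‖g‖ ≤ 1 := hgn.le.trans ((CharacterSpace.norm_le_norm_one φ).trans h1)
  have hg1 : g 1 = 1 := (hgφ (1 : A)).trans (map_one φ)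
  obtain ⟨μ, hreg, hprob, hμ⟩ := exists_regular_isProbabilityMeasure_integral_eq hg hg1
  exact ⟨μ, hreg, hprob, fun f => (hgφ f).symm.trans (hμ f)⟩
end

section
/- Let X be a compact Hausdorff topological space, let B be a closed subalgebra of C(X, ℂ) (with the supremum norm) containing the constant functions, and let φ be a character of B. If f ∈ B and the complex conjugate f̄ also belongs to B, then φ(f̄) = conjugate of φ(f). -/
open WeakDual

/-- The largest star subalgebra contained in a subalgebra. -/
def Subalgebra.starCore {R A : Type*} [CommSemiring R] [StarRing R] [Semiring A] [StarRing A]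
    [Algebra R A] [StarModule R A] (B : Subalgebra R A) : StarSubalgebra R A where
  toSubalgebra := B ⊓ star B
  star_mem' {a} ha := by
    have h : a ∈ B ∧ star a ∈ B := ha
    exact ⟨h.2, show star (star a) ∈ B from (star_star a).symm ▸ h.1⟩

theorem Subalgebra.starCore_le {R A : Type*} [CommSemiring R] [StarRing R] [Semiring A]
    [StarRing A] [Algebra R A] [StarModule R A] (B : Subalgebra R A) :
    B.starCore.toSubalgebra ≤ B :=
  inf_le_left

theorem Subalgebra.isClosed_starCore {R A : Type*} [CommSemiring R] [StarRing R] [Semiring A]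
    [StarRing A] [Algebra R A] [StarModule R A] [TopologicalSpace A] [ContinuousStar A]
    {B : Subalgebra R A} (hB : IsClosed (B : Set A)) : IsClosed (B.starCore : Set A) :=
  hB.inter (hB.preimage continuous_star)

/-- A complex-valued algebra homomorphism on a closed subalgebra of a C⋆-algebra preserves the
star of every element whose star lies in the subalgebra. -/
theorem AlgHom.apply_star_of_isClosed {A : Type*} [CStarAlgebra A] {B : Subalgebra ℂ A}
    (hB : IsClosed (B : Set A)) (φ : B →ₐ[ℂ] ℂ) {a : A} (ha : a ∈ B) (ha' : star a ∈ B) :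
    φ ⟨star a, ha'⟩ = star (φ ⟨a, ha⟩) := by
  have : IsClosed (B.starCore : Set A) := B.isClosed_starCore hB
  let ψ : B.starCore →ₐ[ℂ] ℂ := φ.comp (Subalgebra.inclusion B.starCore_le)
  exact map_star ψ (⟨a, ha, ha'⟩ : B.starCore)

/-- A character of a closed subalgebra of `C(X, ℂ)` respects complex
conjugation whenever the conjugate of a function in the algebra again lies
in the algebra. -/
theorem character_apply_star
    {X : Type*} [TopologicalSpace X] [CompactSpace X] [T2Space X]
    (B : Subalgebra ℂ C(X, ℂ)) (hBclosed : IsClosed (B : Set C(X, ℂ)))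
    (φ : characterSpace ℂ B)
    (f : C(X, ℂ)) (hf : f ∈ B) (hfstar : star f ∈ B) :
    φ ⟨star f, hfstar⟩ = starRingEnd ℂ (φ ⟨f, hf⟩) :=
  AlgHom.apply_star_of_isClosed hBclosed (CharacterSpace.toAlgHom φ) hf hfstar
end

section
/- Let Ω be a bounded open set in ℂⁿ and let A be a closed subalgebra of C_b(Ω, ℂ) containing the constant functions and the coordinate functions z₁,…,zₙ. Suppose Gleason's problem is solvable for A: for every point a = (a₁,…,aₙ) ∈ Ω and every h ∈ A with h(a) = 0 there exist g₁,…,gₙ ∈ A with h = Σᵢ (zᵢ − aᵢ) gᵢ. Then for every character φ of A, if the point a = (φ(z₁),…,φ(zₙ)) lies in Ω, then φ is the evaluation character ev_a (i.e., φ(h) = h(a) for all h ∈ A). -/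
open BoundedContinuousFunction WeakDual

/-- If Gleason's problem is solvable for a closed subalgebra `A` of
`C_b(Ω, ℂ)` containing the constants and the coordinate functions, then every
character of `A` lying over a point of `Ω` is evaluation at that point. -/
theorem character_is_evaluation_of_gleason
    (n : ℕ) (Ω : Set (Fin n → ℂ)) (hΩopen : IsOpen Ω) (hΩbdd : Bornology.IsBounded Ω)
    (A : Subalgebra ℂ (↥Ω →ᵇ ℂ)) (hAclosed : IsClosed (A : Set (↥Ω →ᵇ ℂ)))
    (Z : Fin n → (↥Ω →ᵇ ℂ)) (hZ : ∀ i (z : ↥Ω), Z i z = (z : Fin n → ℂ) i)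
    (hZA : ∀ i, Z i ∈ A)
    (hGleason : ∀ (a : ↥Ω) (h : ↥Ω →ᵇ ℂ), h ∈ A → h a = 0 →
      ∃ g : Fin n → (↥Ω →ᵇ ℂ), (∀ i, g i ∈ A) ∧
        h = ∑ i, (Z i - algebraMap ℂ (↥Ω →ᵇ ℂ) ((a : Fin n → ℂ) i)) * g i)
    (φ : characterSpace ℂ A) (a : ↥Ω) (ha : ∀ i, φ ⟨Z i, hZA i⟩ = (a : Fin n → ℂ) i) :
    ∀ h : A, φ h = (h : ↥Ω →ᵇ ℂ) a := by
  intro h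
  set c : ℂ := (h : ↥Ω →ᵇ ℂ) a with hc
  obtain ⟨g, hgA, hg⟩ := hGleason a ((h - algebraMap ℂ A c : A) : ↥Ω →ᵇ ℂ)
    (h - algebraMap ℂ A c : A).2 (by
      change (h : ↥Ω →ᵇ ℂ) a - (algebraMap ℂ (↥Ω →ᵇ ℂ) c) a = 0
      simp [hc, BoundedContinuousFunction.algebraMap_apply])
  have key : h - algebraMap ℂ A c =
      ∑ i, ((⟨Z i, hZA i⟩ : A) - algebraMap ℂ A ((a : Fin n → ℂ) i)) * ⟨g i, hgA i⟩ := by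
    apply Subtype.ext
    rw [hg]
    simp
  have hφ : φ (h - algebraMap ℂ A c) = 0 := by
    rw [key, map_sum]
    refine Finset.sum_eq_zero fun i _ => ?_
    rw [map_mul, map_sub, ha i, AlgHomClass.commutes, Algebra.algebraMap_self_apply, sub_self,
      zero_mul]
  rwa [map_sub, AlgHomClass.commutes, Algebra.algebraMap_self_apply, sub_eq_zero] at hφ
end

section
/- Let n, m ≥ 1 and let L₁,…,L_m : ℂⁿ → ℂ be ℂ-linear maps. Consider the space V of all ℝ-linear maps from ℂⁿ to ℂ as a complex vector space (with scalar multiplication on the target), which has complex dimension 2n. Let dzᵢ ∈ V denote the i-th coordinate projection (which is ℂ-linear) and let L̄ⱼ ∈ V denote the conjugate map z ↦ conjugate(Lⱼ(z)). If the family {dz₁,…,dzₙ} ∪ {L̄₁,…,L̄_m} spans V over ℂ, then the ℂ-linear map ℂⁿ → ℂᵐ given by z ↦ (L₁(z),…,L_m(z)) is injective (equivalently, has rank n). -/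
/-- If `v` is a common zero of the `ℂ`-linear forms `L j`, then every combination of `ℂ`-linear
forms and conjugates of the `L j` commutes with multiplication by `I` at `v`. -/
theorem apply_I_smul_of_mem_span {E ι κ : Type*} [AddCommGroup E] [Module ℂ E]
    (A : ι → (E →ₗ[ℂ] ℂ)) (L : κ → (E →ₗ[ℂ] ℂ)) {v : E} (hv : ∀ j, L j v = 0)
    {φ : E →ₗ[ℝ] ℂ}
    (hφ : φ ∈ Submodule.span ℂ (Set.range (fun i => (A i).restrictScalars ℝ) ∪
      Set.range (fun j => Complex.conjLIE.toLinearMap ∘ₗ (L j).restrictScalars ℝ))) :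
    φ (Complex.I • v) = Complex.I * φ v := by
  induction hφ using Submodule.span_induction with
  | mem φ h =>
    rcases h with ⟨i, rfl⟩ | ⟨j, rfl⟩
    · simp
    · simp [hv j]
  | zero => simp
  | add φ ψ _ _ hφ hψ => simp only [LinearMap.add_apply, hφ, hψ, mul_add]
  | smul c φ _ hφ => simp only [LinearMap.smul_apply, hφ, smul_eq_mul, mul_left_comm]

/-- If the coordinate forms `dz i` together with the conjugates of the
`ℂ`-linear forms `L j` span the space of `ℝ`-linear `ℂ`-valued forms on `ℂⁿ`, then
`z ↦ (L 1 z, …, L m z)` is injective. -/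
theorem injective_of_span_with_conjugates
    (n m : ℕ) (hn : 1 ≤ n) (hm : 1 ≤ m)
    (L : Fin m → ((Fin n → ℂ) →ₗ[ℂ] ℂ))
    (dz : Fin n → ((Fin n → ℂ) →ₗ[ℝ] ℂ))
    (hdz : ∀ i, dz i = (LinearMap.proj i : (Fin n → ℂ) →ₗ[ℂ] ℂ).restrictScalars ℝ)
    (Lbar : Fin m → ((Fin n → ℂ) →ₗ[ℝ] ℂ))
    (hLbar : ∀ j, Lbar j = Complex.conjLIE.toLinearMap ∘ₗ ((L j).restrictScalars ℝ))
    (hspan : Submodule.span ℂ (Set.range dz ∪ Set.range Lbar) = ⊤) :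
    Function.Injective (fun z : Fin n → ℂ => fun j : Fin m => L j z) := by
  obtain rfl := funext hdz
  obtain rfl := funext hLbar
  intro x y hxy
  have hv : ∀ j, L j (x - y) = 0 := fun j => by
    rw [map_sub, sub_eq_zero]
    exact congrFun hxy j
  ext i
  have h := apply_I_smul_of_mem_span (fun i => LinearMap.proj i) L hv
    (φ := Complex.conjLIE.toLinearMap ∘ₗ
      (LinearMap.proj i : (Fin n → ℂ) →ₗ[ℂ] ℂ).restrictScalars ℝ)
    (hspan ▸ Submodule.mem_top)
  have h' : -(Complex.I * star (x i - y i)) = Complex.I * star (x i - y i) := by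
    simpa using h
  rw [neg_eq_self, mul_eq_zero, or_iff_right Complex.I_ne_zero, star_eq_zero] at h'
  exact sub_eq_zero.mp h'
end
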